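/- arXiv:1611.04853 — 2 statements merged into one kernel-verified Lean document; each statement's English description precedes it below -/
import Mathlib

section
/- Let K be a positive integer, let q ∈ (0,1), and let 0 < h_1 ≤ h_2 ≤ ... ≤ h_K be real channel gains. Define g_d : (0,∞) → ℝ by g_d(s) = Σ_{i=1}^{K−1} (1/h_i^2 − 1/h_{i+1}^2)·2^{(1−q)(1−(1−q)^i)/(q·s)} + (1/h_K^2)·2^{(1−q)(1−(1−q)^K)/(q·s)} − 1/h_1^2 − 1. Then g_d is strictly decreasing on (0,∞), g_d(s) → +∞ as s → 0⁺, g_d(s) → −1 as s → +∞, and consequently g_d has a unique root in (0,∞). -/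
open Finset Real Filter

theorem strictAntiOn_rpow_div {b a q : ℝ} (hb : 1 < b) (ha : 0 < a) (hq : 0 < q) :
    StrictAntiOn (fun s : ℝ => b ^ (a / (q * s))) (Set.Ioi 0) := by
  intro s hs t ht hst
  have hs' : 0 < s := hs
  exact Real.rpow_lt_rpow_of_exponent_lt hb (by gcongr)

theorem continuousOn_rpow_div {b q : ℝ} (hb : 0 < b) (a : ℝ) (hq : 0 < q) :
    ContinuousOn (fun s : ℝ => b ^ (a / (q * s))) (Set.Ioi 0) := by
  refine ContinuousOn.rpow continuousOn_const ?_ fun _ _ => Or.inl hb.ne'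
  exact continuousOn_const.div (by fun_prop) fun s hs => (mul_pos hq hs).ne'

theorem tendsto_rpow_div_nhdsGT_zero {b a q : ℝ} (hb : 1 < b) (ha : 0 < a) (hq : 0 < q) :
    Tendsto (fun s : ℝ => b ^ (a / (q * s))) (nhdsWithin 0 (Set.Ioi 0)) atTop := by
  have hexp : Tendsto (fun s : ℝ => a / (q * s)) (nhdsWithin 0 (Set.Ioi 0)) atTop := by
    refine (tendsto_inv_nhdsGT_zero.const_mul_atTop (div_pos ha hq)).congr fun s => ?_
    rw [← div_eq_mul_inv, div_div]
  exact (tendsto_rpow_atTop_of_base_gt_one b hb).comp hexp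

theorem tendsto_rpow_div_atTop {b q : ℝ} (hb : 0 < b) (a : ℝ) (hq : 0 < q) :
    Tendsto (fun s : ℝ => b ^ (a / (q * s))) atTop (nhds 1) := by
  have hexp : Tendsto (fun s : ℝ => a / (q * s)) atTop (nhds 0) :=
    tendsto_const_nhds.div_atTop (tendsto_id.const_mul_atTop hq)
  simpa using (tendsto_const_nhds (x := b)).rpow hexp (Or.inl hb.ne')

theorem StrictAntiOn.existsUnique_pos_root {g : ℝ → ℝ} {l : ℝ}
    (hanti : StrictAntiOn g (Set.Ioi 0)) (hcont : ContinuousOn g (Set.Ioi 0))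
    (hzero : Tendsto g (nhdsWithin 0 (Set.Ioi 0)) atTop)
    (htop : Tendsto g atTop (nhds l)) (hl : l < 0) : ∃! s : ℝ, 0 < s ∧ g s = 0 := by
  obtain ⟨a, hga, ha⟩ :=
    ((hzero.eventually (eventually_ge_atTop 0)).and self_mem_nhdsWithin).exists
  obtain ⟨b, hgb, hb⟩ := ((htop.eventually_lt_const hl).and (eventually_gt_atTop 0)).exists
  obtain ⟨s, hs, hgs⟩ := isPreconnected_Ioi.intermediate_value hb ha hcont ⟨hgb.le, hga⟩
  exact ⟨s, ⟨hs, hgs⟩, fun t ht => hanti.injOn ht.1 hs (ht.2.trans hgs.symm)⟩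

theorem sum_Icc_one_sub_succ (f : ℕ → ℝ) {K : ℕ} (hK : 1 ≤ K) :
    ∑ i ∈ Finset.Icc 1 (K - 1), (f i - f (i + 1)) = f 1 - f K := by
  obtain ⟨n, rfl⟩ : ∃ n, K = n + 1 := ⟨K - 1, by omega⟩
  rw [Nat.add_sub_cancel]
  clear hK
  induction n with
  | zero => simp
  | succ n ih =>
    rw [Finset.sum_Icc_succ_top (by omega), ih]
    ring

/-- Properties of the function `g_d` whose unique positive root is the transmission
time of the decentralized concurrent delivery scheme: `g_d` is strictly decreasing on
`(0,∞)`, tends to `+∞` as `s → 0⁺`, tends to `-1` as `s → +∞`, and has a unique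
positive root. -/
theorem gd_strictAnti_and_unique_root
    (K : ℕ) (hK : 1 ≤ K) (q : ℝ) (hq : q ∈ Set.Ioo (0 : ℝ) 1) (h : ℕ → ℝ)
    (hpos : ∀ i ∈ Finset.Icc 1 K, 0 < h i)
    (hmono : ∀ i ∈ Finset.Icc 1 (K - 1), h i ≤ h (i + 1)) :
    let g : ℝ → ℝ := fun s =>
      ∑ i ∈ Finset.Icc 1 (K - 1),
        (1 / (h i) ^ 2 - 1 / (h (i + 1)) ^ 2) *
          (2 : ℝ) ^ ((1 - q) * (1 - (1 - q) ^ i) / (q * s))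
      + (1 / (h K) ^ 2) * (2 : ℝ) ^ ((1 - q) * (1 - (1 - q) ^ K) / (q * s))
      - 1 / (h 1) ^ 2 - 1
    StrictAntiOn g (Set.Ioi (0 : ℝ)) ∧
    Tendsto g (nhdsWithin 0 (Set.Ioi (0 : ℝ))) atTop ∧
    Tendsto g atTop (nhds (-1)) ∧
    ∃! s : ℝ, 0 < s ∧ g s = 0 := by
  intro g
  obtain ⟨hq0, hq1⟩ := hq
  have hexp : ∀ i, 1 ≤ i → 0 < (1 - q) * (1 - (1 - q) ^ i) := fun i hi =>
    mul_pos (by linarith)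
      (sub_pos.2 (pow_lt_one₀ (by linarith) (by linarith) (by omega)))
  have hcoeff : ∀ i ∈ Finset.Icc 1 (K - 1), 0 ≤ 1 / (h i) ^ 2 - 1 / (h (i + 1)) ^ 2 := by
    intro i hi
    have hi' := Finset.mem_Icc.1 hi
    have hhi : 0 < h i := hpos i (Finset.mem_Icc.2 ⟨hi'.1, by omega⟩)
    have hle := hmono i hi
    exact sub_nonneg.2 (by gcongr)
  have hlast : 0 < 1 / (h K) ^ 2 := by
    have := hpos K (Finset.mem_Icc.2 ⟨hK, le_rfl⟩)
    positivity
  have hanti : StrictAntiOn g (Set.Ioi 0) := by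
    intro s hs t ht hst
    have hsum : ∑ i ∈ Finset.Icc 1 (K - 1), (1 / (h i) ^ 2 - 1 / (h (i + 1)) ^ 2) *
          (2 : ℝ) ^ ((1 - q) * (1 - (1 - q) ^ i) / (q * t)) ≤
        ∑ i ∈ Finset.Icc 1 (K - 1), (1 / (h i) ^ 2 - 1 / (h (i + 1)) ^ 2) *
          (2 : ℝ) ^ ((1 - q) * (1 - (1 - q) ^ i) / (q * s)) :=
      Finset.sum_le_sum fun i hi => mul_le_mul_of_nonneg_left
        (strictAntiOn_rpow_div one_lt_two (hexp i (Finset.mem_Icc.1 hi).1) hq0 hs ht hst).le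
        (hcoeff i hi)
    have hterm := mul_lt_mul_of_pos_left
      (strictAntiOn_rpow_div one_lt_two (hexp K hK) hq0 hs ht hst) hlast
    dsimp only [g] at hterm ⊢
    linarith
  have hcont : ContinuousOn g (Set.Ioi 0) :=
    (((continuousOn_finsetSum _ fun i _ => continuousOn_const.mul
      (continuousOn_rpow_div two_pos _ hq0)).add (continuousOn_const.mul
      (continuousOn_rpow_div two_pos _ hq0))).sub continuousOn_const).sub continuousOn_const
  have hzero : Tendsto g (nhdsWithin 0 (Set.Ioi 0)) atTop := by
    have hterm := (tendsto_rpow_div_nhdsGT_zero one_lt_two (hexp K hK) hq0).const_mul_atTop hlast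
    refine tendsto_atTop_mono (fun s => ?_)
      (tendsto_atTop_add_const_right _ (-(1 / (h 1) ^ 2) - 1) hterm)
    have hsum : 0 ≤ ∑ i ∈ Finset.Icc 1 (K - 1), (1 / (h i) ^ 2 - 1 / (h (i + 1)) ^ 2) *
          (2 : ℝ) ^ ((1 - q) * (1 - (1 - q) ^ i) / (q * s)) :=
      Finset.sum_nonneg fun i hi => mul_nonneg (hcoeff i hi) (by positivity)
    dsimp only [g]
    linarith
  have htop : Tendsto g atTop (nhds (-1)) := by
    have hlim : Tendsto g atTop (nhds (∑ i ∈ Finset.Icc 1 (K - 1),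
        (1 / (h i) ^ 2 - 1 / (h (i + 1)) ^ 2) * 1 + (1 / (h K) ^ 2) * 1 - 1 / (h 1) ^ 2 - 1)) :=
      (((tendsto_finsetSum _ fun i _ => (tendsto_rpow_div_atTop two_pos _ hq0).const_mul _).add
        ((tendsto_rpow_div_atTop two_pos _ hq0).const_mul _)).sub_const _).sub_const _
    convert hlim using 2
    simp only [mul_one]
    rw [sum_Icc_one_sub_succ (fun i => 1 / (h i) ^ 2) hK]
    ring
  exact ⟨hanti, hzero, htop, hanti.existsUnique_pos_root hcont hzero htop (by norm_num)⟩
end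

section
/- Let K, t be integers with 1 ≤ t < K. Then 1 ≤ ( Σ_{j=1}^{K} ((K−t)/K)^j ) / ( Σ_{i=1}^{K−t} C(K−i,t)/C(K,t) ) ≤ 3/2, where C(n,k) denotes the binomial coefficient. Equivalently, since Σ_{i=1}^{K−t} C(K−i,t) = C(K,t+1) and Σ_{j=1}^{K} (1−t/K)^j = ((K−t)/t)·(1−(1−t/K)^K), the ratio equals ((t+1)/t)·(1 − (1 − t/K)^K) and lies in the interval [1, 3/2]; moreover the value 3/2 is attained exactly at K = 2, t = 1 in the limiting (equality) case. -/
open Finset Real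

/-- The hockey-stick identity, with the upper indices listed downwards. -/
theorem sum_choose_sub_eq (K t : ℕ) (htK : t < K) :
    ∑ i ∈ Finset.Icc 1 (K - t), (K - i).choose t = K.choose (t + 1) := by
  have hK : K - 1 + 1 = K := by omega
  rw [← hK, ← Nat.sum_Icc_choose, hK]
  refine Finset.sum_nbij' (fun i => K - i) (fun i => K - i) ?_ ?_ ?_ ?_ fun _ _ => rfl
  all_goals
    intro i hi
    simp only [Finset.mem_Icc] at hi ⊢
    omega

theorem sum_one_sub_pow_eq {p : ℝ} (hp : p ≠ 0) (n : ℕ) :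
    ∑ j ∈ Finset.Icc 1 n, (1 - p) ^ j = (1 - p) / p * (1 - (1 - p) ^ n) := by
  induction n with
  | zero => simp
  | succ n ih =>
    rw [Finset.sum_Icc_succ_top (by omega), ih]
    field_simp
    ring

theorem one_sub_div_pow_le_inv {K t : ℕ} (htK : t ≤ K) :
    (1 - (t : ℝ) / K) ^ K ≤ ((t : ℝ) + 1)⁻¹ := by
  calc (1 - (t : ℝ) / K) ^ K ≤ Real.exp (-t) :=
        Real.one_sub_div_pow_le_exp_neg (by exact_mod_cast htK)
    _ ≤ ((t : ℝ) + 1)⁻¹ := by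
        rw [Real.exp_neg]
        exact inv_anti₀ (by positivity) (Real.add_one_le_exp _)

theorem exp_neg_one_le_one_sub_inv_pow {n : ℕ} (hn : 0 < n) :
    Real.exp (-1) ≤ (1 - 1 / ((n : ℝ) + 1)) ^ n := by
  have hn' : (0 : ℝ) < n := by exact_mod_cast hn
  have h : Real.exp (-(1 / n)) ≤ 1 - 1 / ((n : ℝ) + 1) := by
    rw [Real.exp_neg]
    calc (Real.exp (1 / n))⁻¹ ≤ (1 / (n : ℝ) + 1)⁻¹ :=
          inv_anti₀ (by positivity) (Real.add_one_le_exp _)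
      _ = 1 - 1 / ((n : ℝ) + 1) := by
          field_simp
          ring
  calc Real.exp (-1) = Real.exp (-(1 / n)) ^ n := by
        rw [← Real.exp_nat_mul]
        congr 1
        field_simp
    _ ≤ _ := pow_le_pow_left₀ (Real.exp_pos _).le h n

theorem quarter_lt_one_sub_inv_pow {K : ℕ} (hK : 3 ≤ K) :
    (1 / 4 : ℝ) < (1 - 1 / (K : ℝ)) ^ K := by
  obtain rfl | hK := hK.eq_or_lt
  · norm_num
  obtain ⟨n, rfl⟩ : ∃ n, K = n + 1 := ⟨K - 1, by omega⟩
  have hn : (3 : ℝ) ≤ n := by exact_mod_cast (by omega : 3 ≤ n)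
  have hexp : (1 / 3 : ℝ) < Real.exp (-1) := by
    rw [Real.exp_neg, ← one_div]
    exact one_div_lt_one_div_of_lt (Real.exp_pos 1) (by linarith [Real.exp_one_lt_d9])
  have hpow := exp_neg_one_le_one_sub_inv_pow (n := n) (by omega)
  have hbase : (3 / 4 : ℝ) ≤ 1 - 1 / ((n : ℝ) + 1) := by
    have : 1 / ((n : ℝ) + 1) ≤ 1 / 4 := one_div_le_one_div_of_le (by norm_num) (by linarith)
    linarith
  push_cast
  rw [pow_succ]
  nlinarith

/-- Among the pairs with `1 ≤ t < K`, only `K = 2`, `t = 1` fails the strict bound. -/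
theorem ratio_lt_three_halves {K t : ℕ} (ht : 1 ≤ t) (htK : t < K) (hne : ¬(K = 2 ∧ t = 1)) :
    ((t : ℝ) + 1) / t * (1 - (1 - (t : ℝ) / K) ^ K) < 3 / 2 := by
  obtain rfl | ht2 := ht.eq_or_lt
  · have := quarter_lt_one_sub_inv_pow (K := K) (by omega)
    push_cast
    linarith
  · have ht' : (2 : ℝ) ≤ t := by exact_mod_cast ht2
    have hK : (0 : ℝ) < K := by linarith [(by exact_mod_cast htK : (t : ℝ) < K)]
    have hx : 0 < (1 - (t : ℝ) / K) ^ K := by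
      refine pow_pos (sub_pos.2 ((div_lt_one hK).2 ?_)) K
      exact_mod_cast htK
    have hc : ((t : ℝ) + 1) / t ≤ 3 / 2 := by
      rw [div_le_iff₀ (by linarith)]
      linarith
    have hc0 : 0 < ((t : ℝ) + 1) / t := by positivity
    nlinarith [mul_pos hc0 hx]

/-- The rate-gap bound used in Appendix E of the paper: with
`a i = C(K-i,t)/C(K,t)` and `b j = ((K-t)/K)^j = (1-q)^j` for `q = t/K`, the ratio
`R = (Σ_{j=1}^K b j)/(Σ_{i=1}^{K-t} a i)` satisfies `1 ≤ R ≤ 3/2`; moreover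
`Σ_{i=1}^{K-t} C(K-i,t) = C(K,t+1)`,
`Σ_{j=1}^K (1-t/K)^j = ((K-t)/t)·(1-(1-t/K)^K)`, the ratio equals
`((t+1)/t)·(1-(1-t/K)^K)`, and `R = 3/2` holds exactly when `K = 2` and `t = 1`. -/
theorem rate_gap_ratio_bounds
    (K t : ℕ) (ht : 1 ≤ t) (htK : t < K) :
    let R : ℝ :=
      (∑ j ∈ Finset.Icc 1 K, (((K - t : ℕ) : ℝ) / (K : ℝ)) ^ j) /
        (∑ i ∈ Finset.Icc 1 (K - t), ((K - i).choose t : ℝ) / (K.choose t : ℝ))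
    (1 ≤ R) ∧ (R ≤ 3 / 2) ∧
    (∑ i ∈ Finset.Icc 1 (K - t), (K - i).choose t = K.choose (t + 1)) ∧
    (∑ j ∈ Finset.Icc 1 K, (1 - (t : ℝ) / (K : ℝ)) ^ j =
      (((K : ℝ) - (t : ℝ)) / (t : ℝ)) * (1 - (1 - (t : ℝ) / (K : ℝ)) ^ K)) ∧
    (R = (((t : ℝ) + 1) / (t : ℝ)) * (1 - (1 - (t : ℝ) / (K : ℝ)) ^ K)) ∧
    (R = 3 / 2 ↔ K = 2 ∧ t = 1) := by
  intro R
  have ht0 : (0 : ℝ) < t := by exact_mod_cast ht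
  have htK' : (t : ℝ) < K := by exact_mod_cast htK
  have hK0 : (0 : ℝ) < K := ht0.trans htK'
  have hcast : ((K - t : ℕ) : ℝ) / K = 1 - (t : ℝ) / K := by
    rw [Nat.cast_sub htK.le, sub_div, div_self hK0.ne']
  have hsum := sum_choose_sub_eq K t htK
  have hgeom : ∑ j ∈ Finset.Icc 1 K, (1 - (t : ℝ) / (K : ℝ)) ^ j =
      (((K : ℝ) - (t : ℝ)) / (t : ℝ)) * (1 - (1 - (t : ℝ) / (K : ℝ)) ^ K) := by
    rw [sum_one_sub_pow_eq (div_pos ht0 hK0).ne']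
    congr 1
    field_simp
  have hload : ∑ i ∈ Finset.Icc 1 (K - t), ((K - i).choose t : ℝ) / (K.choose t : ℝ) =
      ((K : ℝ) - t) / (t + 1) := by
    have hchoose : (0 : ℝ) < K.choose t := by exact_mod_cast Nat.choose_pos htK.le
    have hrec : (K.choose (t + 1) : ℝ) * (t + 1) = K.choose t * ((K : ℝ) - t) := by
      rw [← Nat.cast_sub htK.le]
      exact_mod_cast Nat.choose_succ_right_eq K t
    rw [← Finset.sum_div, ← Nat.cast_sum, hsum, div_eq_div_iff hchoose.ne' (by positivity), hrec,
      mul_comm]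
  have hR : R = (((t : ℝ) + 1) / (t : ℝ)) * (1 - (1 - (t : ℝ) / (K : ℝ)) ^ K) := by
    have hsub : (K : ℝ) - t ≠ 0 := (sub_pos.2 htK').ne'
    simp only [R]
    rw [hcast, hgeom, hload]
    generalize (1 - (t : ℝ) / (K : ℝ)) ^ K = x
    field_simp
  have heq : K = 2 ∧ t = 1 → R = 3 / 2 := by
    intro h
    rw [hR, h.1, h.2]
    norm_num
  have hlt : ¬(K = 2 ∧ t = 1) → R < 3 / 2 := fun h => hR ▸ ratio_lt_three_halves ht htK h
  refine ⟨?_, ?_, hsum, hgeom, hR, fun h => by_contra fun hne => (hlt hne).ne h, heq⟩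
  · have hx := one_sub_div_pow_le_inv htK.le
    calc (1 : ℝ) = (t + 1) / t * (1 - ((t : ℝ) + 1)⁻¹) := by
          field_simp
          ring
      _ ≤ R := by
          rw [hR]
          gcongr
  · by_cases h : K = 2 ∧ t = 1
    · exact (heq h).le
    · exact (hlt h).le
end
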